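/- arXiv:math/0009203 — 3 statements merged into one kernel-verified Lean document; each statement's English description precedes it below -/
import Mathlib

section
/- Let g ≥ 2 and p ≥ 1 be integers, let r₁ ≥ 1 and r₂ ≥ 0 be integers with r₁ + r₂ = p, and let d_P, d_Q, d₁, w be integers satisfying (d₁ : ℚ)/r₁ ≤ (d_P + d_Q)/(2p) and w ≥ d_P − d₁. Then, in ℚ, (d_P + w − 2r₂(g−1))/(p + r₂) − (d_P + d_Q)/(2p) ≥ (d_P − d_Q − 2r₂(g−1))/(p + r₂). -/
/-- The slope estimate in Lemma 3.4: with `r₁ + r₂ = p`, `r₁ ≥ 1`, `r₂ ≥ 0`, `g ≥ 2`,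
`d₁/r₁ ≤ (d_P + d_Q)/(2p)` and `w ≥ d_P - d₁`, one has
`(d_P + w - 2r₂(g-1))/(p + r₂) - (d_P + d_Q)/(2p) ≥ (d_P - d_Q - 2r₂(g-1))/(p + r₂)`. -/
theorem stmt_1 (g p r₁ r₂ dP dQ d₁ w : ℤ) (hg : 2 ≤ g) (hp : 1 ≤ p)
    (hr₁ : 1 ≤ r₁) (hr₂ : 0 ≤ r₂) (hsum : r₁ + r₂ = p)
    (hss : (d₁ : ℚ) / (r₁ : ℚ) ≤ ((dP : ℚ) + (dQ : ℚ)) / (2 * (p : ℚ)))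
    (hw : w ≥ dP - d₁) :
    ((dP : ℚ) + (w : ℚ) - 2 * (r₂ : ℚ) * ((g : ℚ) - 1)) / ((p : ℚ) + (r₂ : ℚ))
        - ((dP : ℚ) + (dQ : ℚ)) / (2 * (p : ℚ))
      ≥ ((dP : ℚ) - (dQ : ℚ) - 2 * (r₂ : ℚ) * ((g : ℚ) - 1)) / ((p : ℚ) + (r₂ : ℚ)) := by
  have hp' : (0 : ℚ) < p := by exact_mod_cast hp
  have hr₁' : (0 : ℚ) < r₁ := by exact_mod_cast hr₁
  have hr₂' : (0 : ℚ) ≤ r₂ := by exact_mod_cast hr₂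
  have hsum' : (r₁ : ℚ) + r₂ = p := by exact_mod_cast hsum
  have hw' : (dP : ℚ) - d₁ ≤ w := by exact_mod_cast hw
  have hpr : (0 : ℚ) < (p : ℚ) + r₂ := by linarith
  have hμ : ((dP : ℚ) + dQ) / (2 * p) * (2 * p) = dP + dQ :=
    div_mul_cancel₀ _ (by positivity)
  generalize ((dP : ℚ) + dQ) / (2 * p) = μ at hss hμ ⊢
  rw [div_le_iff₀ hr₁'] at hss
  have hrank : μ * r₁ + μ * r₂ = μ * p := by rw [← mul_add, hsum']
  rw [ge_iff_le, le_sub_iff_add_le, div_add' _ _ _ hpr.ne', div_le_div_iff_of_pos_right hpr]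
  linarith
end

section
/- Let g ≥ 2 and p ≥ 1 be integers, let r₁ ≥ 1 and r₂ ≥ 0 be integers with r₁ + r₂ = p, and let d_P, d_Q, d₁, w be integers satisfying (d₁ : ℚ)/r₁ ≤ (d_P + d_Q)/(2p), w ≥ d_P − d₁, and d_P − d_Q > 2(p−1)(g−1). Then, in ℚ, (d_P + w − 2r₂(g−1))/(p + r₂) > (d_P + d_Q)/(2p). -/
/-- The destabilization step in Lemma 3.4: with `r₁ + r₂ = p`, `r₁ ≥ 1`, `r₂ ≥ 0`, `g ≥ 2`,
`d₁/r₁ ≤ (d_P + d_Q)/(2p)`, `w ≥ d_P - d₁` and `d_P - d_Q > 2(p-1)(g-1)`, one has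
`(d_P + w - 2r₂(g-1))/(p + r₂) > (d_P + d_Q)/(2p)`. -/
theorem stmt_2 (g p r₁ r₂ dP dQ d₁ w : ℤ) (hg : 2 ≤ g) (hp : 1 ≤ p)
    (hr₁ : 1 ≤ r₁) (hr₂ : 0 ≤ r₂) (hsum : r₁ + r₂ = p)
    (hss : (d₁ : ℚ) / (r₁ : ℚ) ≤ ((dP : ℚ) + (dQ : ℚ)) / (2 * (p : ℚ)))
    (hw : w ≥ dP - d₁)
    (hτ : (dP : ℚ) - (dQ : ℚ) > 2 * ((p : ℚ) - 1) * ((g : ℚ) - 1)) :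
    ((dP : ℚ) + (w : ℚ) - 2 * (r₂ : ℚ) * ((g : ℚ) - 1)) / ((p : ℚ) + (r₂ : ℚ))
      > ((dP : ℚ) + (dQ : ℚ)) / (2 * (p : ℚ)) := by
  have hr₁' : (1 : ℚ) ≤ r₁ := by exact_mod_cast hr₁
  have hr₂' : (0 : ℚ) ≤ r₂ := by exact_mod_cast hr₂
  have hg' : (2 : ℚ) ≤ g := by exact_mod_cast hg
  have hp' : (1 : ℚ) ≤ p := by exact_mod_cast hp
  have hsum' : (r₁ : ℚ) + r₂ = p := by exact_mod_cast hsum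
  have hw' : (dP : ℚ) - d₁ ≤ w := by exact_mod_cast hw
  have hμ : ((dP : ℚ) + dQ) / (2 * p) * (2 * p) = dP + dQ :=
    div_mul_cancel₀ _ (by positivity)
  generalize ((dP : ℚ) + dQ) / (2 * p) = μ at hss hμ ⊢
  rw [div_le_iff₀ (by linarith)] at hss
  rw [gt_iff_lt, lt_div_iff₀ (by linarith)]
  have hr₂g : (r₂ : ℚ) * (g - 1) ≤ (p - 1) * (g - 1) :=
    mul_le_mul_of_nonneg_right (by linarith) (by linarith)
  rw [← hsum'] at hμ hτ hr₂g ⊢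
  linarith
end

section
/- Let Y be a Hausdorff topological space equipped with a continuous action of the multiplicative group ℂˣ of nonzero complex numbers. For y ∈ Y, say lim_{t→0} t·y = x if the map t ↦ t·y tends to x along the filter of punctured neighborhoods of 0 in ℂ (intersected with ℂˣ), and say lim_{t→∞} t·y = x if t ↦ t⁻¹·y tends to x along the same filter. Assume: (i) for every y ∈ Y, lim_{t→0} t·y exists in Y; (ii) there is a function β : Y → ℤ with finite image such that whenever y is not a fixed point of the action and both x₀ = lim_{t→0} t·y and x_∞ = lim_{t→∞} t·y exist, one has β(x₀) < β(x_∞). Suppose U is a subset of the fixed-point set of the action such that for every fixed point x ∉ U there exists y ≠ x with lim_{t→∞} t·y = x. Then U intersects every connected component of Y. -/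
open Filter Topology

/-- `limAtZero y x` : the map `t ↦ t • y` tends to `x` along the filter of punctured
neighborhoods of `0` in `ℂ` (pulled back to `ℂˣ`), i.e. `lim_{t → 0} t • y = x`. -/
def limAtZero {Y : Type*} [TopologicalSpace Y] [MulAction ℂˣ Y] (y x : Y) : Prop :=
  Filter.Tendsto (fun t : ℂˣ => t • y)
    (Filter.comap (Units.val : ℂˣ → ℂ) (𝓝[≠] (0 : ℂ))) (𝓝 x)

/-- `limAtInfty y x` : the map `t ↦ t⁻¹ • y` tends to `x` along the filter of punctured
neighborhoods of `0` in `ℂ` (pulled back to `ℂˣ`), i.e. `lim_{t → ∞} t • y = x`. -/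
def limAtInfty {Y : Type*} [TopologicalSpace Y] [MulAction ℂˣ Y] (y x : Y) : Prop :=
  Filter.Tendsto (fun t : ℂˣ => t⁻¹ • y)
    (Filter.comap (Units.val : ℂˣ → ℂ) (𝓝[≠] (0 : ℂ))) (𝓝 x)

section Limits

variable {Y : Type*} [TopologicalSpace Y] [MulAction ℂˣ Y]

theorem neBot_comap_val_nhdsNE_zero :
    (comap (Units.val : ℂˣ → ℂ) (𝓝[≠] (0 : ℂ))).NeBot := by
  refine NeBot.comap_of_range_mem inferInstance ?_
  filter_upwards [self_mem_nhdsWithin] with z hz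
  exact ⟨Units.mk0 z hz, rfl⟩

theorem tendsto_mul_right_comap_val_nhdsNE_zero (s : ℂˣ) :
    Tendsto (fun t : ℂˣ => t * s) (comap (Units.val : ℂˣ → ℂ) (𝓝[≠] (0 : ℂ)))
      (comap (Units.val : ℂˣ → ℂ) (𝓝[≠] (0 : ℂ))) := by
  refine tendsto_comap_iff.2 (tendsto_nhdsWithin_iff.2
    ⟨?_, Eventually.of_forall fun t => (t * s).ne_zero⟩)
  have h : Tendsto (Units.val : ℂˣ → ℂ) (comap Units.val (𝓝[≠] (0 : ℂ))) (𝓝 0) :=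
    tendsto_comap.mono_right nhdsWithin_le_nhds
  simpa [Function.comp_def] using h.mul_const (s : ℂ)

/-- A limit of `t • y` as `t → 0` is a fixed point of the action. -/
theorem limAtZero.smul_eq [T2Space Y] [ContinuousSMul ℂˣ Y] {y x : Y}
    (h : limAtZero y x) (s : ℂˣ) : s • x = x := by
  have := neBot_comap_val_nhdsNE_zero
  have h₁ := Tendsto.const_smul h s
  have h₂ := Tendsto.comp h (tendsto_mul_right_comap_val_nhdsNE_zero s)
  refine tendsto_nhds_unique h₁ (h₂.congr fun t => ?_)
  simp [mul_comm t s, mul_smul]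

theorem limAtInfty.eq_of_fixed [T2Space Y] {y x : Y} (h : limAtInfty y x)
    (hy : ∀ t : ℂˣ, t • y = y) : y = x := by
  have := neBot_comap_val_nhdsNE_zero
  exact tendsto_nhds_unique (tendsto_const_nhds.congr fun t => (hy t⁻¹).symm) h

theorem preconnectedSpace_complex_units : PreconnectedSpace ℂˣ := by
  have hc : Continuous fun z : ℂ => Units.mk0 (Complex.exp z) (Complex.exp_ne_zero z) :=
    Units.continuous_iff.2 ⟨Complex.continuous_exp, by
      simpa [Function.comp_def, ← Complex.exp_neg] using
        Complex.continuous_exp.comp continuous_neg⟩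
  have hs : Function.Surjective
      fun z : ℂ => Units.mk0 (Complex.exp z) (Complex.exp_ne_zero z) := fun t =>
    ⟨Complex.log t, Units.ext (Complex.exp_log t.ne_zero)⟩
  exact ⟨hs.range_eq ▸ isPreconnected_range hc⟩

theorem smul_mem_connectedComponent [ContinuousSMul ℂˣ Y] (y : Y) (t : ℂˣ) :
    t • y ∈ connectedComponent y := by
  have := preconnectedSpace_complex_units
  have h : IsPreconnected (Set.range fun t : ℂˣ => t • y) :=
    isPreconnected_range (by fun_prop)
  exact h.subset_connectedComponent ⟨1, one_smul _ y⟩ ⟨t, rfl⟩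

theorem limAtZero.mem_connectedComponent [ContinuousSMul ℂˣ Y] {y x : Y}
    (h : limAtZero y x) : x ∈ connectedComponent y := by
  have := neBot_comap_val_nhdsNE_zero
  exact isClosed_connectedComponent.mem_of_tendsto h
    (Eventually.of_forall (smul_mem_connectedComponent y))

theorem limAtInfty.mem_connectedComponent [ContinuousSMul ℂˣ Y] {y x : Y}
    (h : limAtInfty y x) : x ∈ connectedComponent y := by
  have := neBot_comap_val_nhdsNE_zero
  exact isClosed_connectedComponent.mem_of_tendsto h
    (Eventually.of_forall fun t => smul_mem_connectedComponent y t⁻¹)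

end Limits

/-- Lemma 4.6 (a variant of Simpson's Lemma 11.8): for a continuous `ℂˣ`-action
on a Hausdorff space `Y` such that `lim_{t→0} t • y` always exists, with a weight
function `β` with finite image that strictly increases from the limit at `0` to the
limit at `∞` of any non-fixed point, if `U` is a set of fixed points such that every
fixed point outside `U` is `lim_{t→∞} t • y` for some `y ≠ x`, then `U` meets every
connected component of `Y`. -/
theorem stmt_4 {Y : Type*} [TopologicalSpace Y] [T2Space Y]
    [MulAction ℂˣ Y] [ContinuousSMul ℂˣ Y]
    (hlim : ∀ y : Y, ∃ x : Y, limAtZero y x)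
    (β : Y → ℤ) (hβfin : (Set.range β).Finite)
    (hβ : ∀ y x₀ xinf : Y, (¬ ∀ t : ℂˣ, t • y = y) →
      limAtZero y x₀ → limAtInfty y xinf → β x₀ < β xinf)
    (U : Set Y) (hUfix : ∀ x ∈ U, ∀ t : ℂˣ, t • x = x)
    (hflow : ∀ x : Y, (∀ t : ℂˣ, t • x = x) → x ∉ U →
      ∃ y : Y, y ≠ x ∧ limAtInfty y x) :
    ∀ x : Y, (U ∩ connectedComponent x).Nonempty := by
  intro z
  let S : Set Y := {x | (∀ t : ℂˣ, t • x = x) ∧ x ∈ connectedComponent z}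
  obtain ⟨z₀, hz₀⟩ := hlim z
  have hS : (β '' S).Nonempty := ⟨β z₀, z₀, ⟨hz₀.smul_eq, hz₀.mem_connectedComponent⟩, rfl⟩
  obtain ⟨_, ⟨x, ⟨hxfix, hxz⟩, rfl⟩, hmin⟩ :=
    Set.exists_min_image (β '' S) id (hβfin.subset (Set.image_subset_range β S)) hS
  refine ⟨x, by_contra fun hxU => ?_, hxz⟩
  obtain ⟨y, hyx, hy⟩ := hflow x hxfix hxU
  obtain ⟨x₀, hx₀⟩ := hlim y
  have hlt : β x₀ < β x := hβ y x₀ x (fun hfix => hyx (hy.eq_of_fixed hfix)) hx₀ hy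
  have hmem : x₀ ∈ connectedComponent z := by
    rw [connectedComponent_eq hxz, ← connectedComponent_eq hy.mem_connectedComponent]
    exact hx₀.mem_connectedComponent
  exact hlt.not_ge (hmin (β x₀) ⟨x₀, ⟨hx₀.smul_eq, hmem⟩, rfl⟩)
end
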